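/- Let p be a prime with p ≠ 2 and p ≠ 5. If p ≡ ±1 (mod 10), then 2F_{p-1} - F_{2p-2} ≡ 0 (mod p²) and 2L_{p-1} - L_{2p-2} ≡ 2 (mod p²). If p ≡ ±3 (mod 10), then 2F_{p-2} + F_{2p-1} ≡ -2 (mod p²) and 2L_{p-2} + L_{2p-1} ≡ 4 (mod p²). -/

import Mathlib

/-- The Lucas numbers: `L_0 = 2`, `L_1 = 1`, `L_{n+1} = L_n + L_{n-1}`. -/
def lucasL : ℕ → ℤ
  | 0 => 2
  | 1 => 1
  | n + 2 => lucasL (n + 1) + lucasL n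

theorem lucasL_eq_two_mul_fib_sub (n : ℕ) :
    lucasL n = 2 * (Nat.fib (n + 1) : ℤ) - Nat.fib n := by
  induction n using Nat.twoStepInduction with
  | zero => simp [lucasL]
  | one => simp [lucasL]
  | more n ih₀ ih₁ =>
    rw [lucasL, ih₀, ih₁, Nat.fib_add_two (n := n + 1), Nat.fib_add_two (n := n)]
    push_cast
    ring

theorem pow_succ_eq_fib_mul_add_fib {R : Type*} [CommRing R] {x : R} (hx : x ^ 2 = x + 1)
    (n : ℕ) : x ^ (n + 1) = Nat.fib (n + 1) * x + Nat.fib n := by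
  induction n with
  | zero => simp
  | succ n ih =>
    rw [pow_succ, ih, Nat.fib_add_two]
    push_cast
    linear_combination (Nat.fib (n + 1) : R) * hx

theorem fib_prime_mul_one_add_add {K : Type*} [Field K] {p : ℕ} [Fact p.Prime] [CharP K p]
    (h2 : (2 : K) ≠ 0) (hp : p ≠ 2) {s : K} (hs : s ^ 2 = 5) :
    (Nat.fib p : K) * (1 + s) + 2 * Nat.fib (p - 1) = 1 + 5 ^ (p / 2) * s := by
  have hpos : p - 1 + 1 = p := Nat.sub_add_cancel (Fact.out : p.Prime).one_le
  have hx : ((1 + s) / 2) ^ 2 = (1 + s) / 2 + 1 := by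
    field_simp
    linear_combination hs
  have hpow := pow_succ_eq_fib_mul_add_fib hx (p - 1)
  have htwo : (2 : K) ^ p = 2 := by
    rw [← one_add_one_eq_two, add_pow_char, one_pow]
  have hsp : s ^ p = 5 ^ (p / 2) * s := by
    conv_lhs => rw [← Nat.two_mul_div_two_add_one_of_odd ((Fact.out : p.Prime).odd_of_ne_two hp)]
    rw [pow_succ, pow_mul, hs]
  rw [hpos, div_pow, add_pow_char, one_pow, htwo, hsp] at hpow
  field_simp at hpow
  linear_combination -hpow

/-- The residues of `F_p` and `F_{p-1}` modulo `p`, in terms of the value of Euler's criterion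
at `5`. -/
theorem fib_prime_eq_five_pow {p : ℕ} [Fact p.Prime] (h2 : p ≠ 2) (h5 : p ≠ 5) :
    (Nat.fib p : ZMod p) = 5 ^ (p / 2) ∧
      2 * (Nat.fib (p - 1) : ZMod p) = 1 - 5 ^ (p / 2) := by
  let K := AlgebraicClosure (ZMod p)
  have : CharP K p := charP_of_injective_algebraMap (algebraMap (ZMod p) K).injective p
  have hne {q : ℕ} (hq : q.Prime) (hpq : p ≠ q) : (q : K) ≠ 0 := by
    rwa [Ne, CharP.cast_eq_zero_iff K p, Nat.prime_dvd_prime_iff_eq Fact.out hq]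
  have h2K : (2 : K) ≠ 0 := mod_cast hne Nat.prime_two h2
  have h5K : (5 : K) ≠ 0 := mod_cast hne Nat.prime_five h5
  obtain ⟨s, hs⟩ := IsAlgClosed.exists_pow_nat_eq (5 : K) two_pos
  have hs0 : s ≠ 0 := by
    rintro rfl
    exact h5K (by simpa using hs.symm)
  have hpos := fib_prime_mul_one_add_add h2K h2 hs
  have hneg := fib_prime_mul_one_add_add h2K h2 (s := -s) (by rw [neg_sq, hs])
  have hfib : (Nat.fib p : K) = 5 ^ (p / 2) := by
    apply mul_left_cancel₀ (mul_ne_zero h2K hs0)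
    linear_combination hpos - hneg
  constructor <;> apply (algebraMap (ZMod p) K).injective
  · simpa only [map_natCast, map_pow, map_ofNat] using hfib
  · have : 2 * (Nat.fib (p - 1) : K) = 1 - 5 ^ (p / 2) := by
      linear_combination hpos - (1 + s) * hfib
    simpa only [map_natCast, map_pow, map_ofNat, map_sub, map_mul, map_one] using this

theorem isSquare_five_iff {p : ℕ} [Fact p.Prime] (h2 : p ≠ 2) :
    IsSquare (5 : ZMod p) ↔ IsSquare ((p % 5 : ℕ) : ZMod 5) := by
  have : Fact (Nat.Prime 5) := ⟨Nat.prime_five⟩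
  have h := ZMod.exists_sq_eq_prime_iff_of_mod_four_eq_one (p := 5) (q := p) (by norm_num) h2
  rw [ZMod.natCast_mod]
  exact_mod_cast h.symm

theorem ZMod.natCast_prime_ne_zero {p q : ℕ} (hp : p.Prime) (hq : q.Prime) (hpq : p ≠ q) :
    (q : ZMod p) ≠ 0 := by
  rwa [Ne, ZMod.natCast_eq_zero_iff, Nat.prime_dvd_prime_iff_eq hp hq]

theorem dvd_fib_of_mod_ten_eq_one_or_nine {p : ℕ} (hp : p.Prime)
    (h : p % 10 = 1 ∨ p % 10 = 9) :
    (p : ℤ) ∣ Nat.fib (p - 1) ∧ (p : ℤ) ∣ Nat.fib p - 1 := by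
  have := Fact.mk hp
  have h2 : p ≠ 2 := by omega
  have h5 : p ≠ 5 := by omega
  have h2' : (2 : ZMod p) ≠ 0 := mod_cast ZMod.natCast_prime_ne_zero hp Nat.prime_two h2
  have h5' : (5 : ZMod p) ≠ 0 := mod_cast ZMod.natCast_prime_ne_zero hp Nat.prime_five h5
  have hsq : IsSquare (5 : ZMod p) := by
    rw [isSquare_five_iff h2]
    obtain h | h : p % 5 = 1 ∨ p % 5 = 4 := by omega
    all_goals rw [h]; decide
  obtain ⟨hF, hF'⟩ := fib_prime_eq_five_pow h2 h5
  rw [(ZMod.euler_criterion p h5').mp hsq] at hF hF'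
  constructor <;> rw [← ZMod.intCast_zmod_eq_zero_iff_dvd]
  · simpa [h2'] using hF'
  · simp [hF]

theorem dvd_fib_of_mod_ten_eq_three_or_seven {p : ℕ} (hp : p.Prime)
    (h : p % 10 = 3 ∨ p % 10 = 7) :
    (p : ℤ) ∣ Nat.fib (p + 1) ∧ (p : ℤ) ∣ Nat.fib p + 1 := by
  have := Fact.mk hp
  have h2 : p ≠ 2 := by omega
  have h5 : p ≠ 5 := by omega
  have h2' : (2 : ZMod p) ≠ 0 := mod_cast ZMod.natCast_prime_ne_zero hp Nat.prime_two h2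
  have h5' : (5 : ZMod p) ≠ 0 := mod_cast ZMod.natCast_prime_ne_zero hp Nat.prime_five h5
  have hsq : ¬ IsSquare (5 : ZMod p) := by
    rw [isSquare_five_iff h2]
    obtain h | h : p % 5 = 3 ∨ p % 5 = 2 := by omega
    all_goals rw [h]; decide
  obtain ⟨hF, hF'⟩ := fib_prime_eq_five_pow h2 h5
  rw [(ZMod.pow_div_two_eq_neg_one_or_one p h5').resolve_left
    ((ZMod.euler_criterion p h5').not.mp hsq)] at hF hF'
  constructor <;> rw [← ZMod.intCast_zmod_eq_zero_iff_dvd]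
  · rw [Nat.fib_add_one hp.ne_zero]
    push_cast
    apply mul_left_cancel₀ h2'
    linear_combination hF' + 2 * hF
  · simp [hF]

theorem fib_two_mul_int (n : ℕ) :
    (Nat.fib (2 * n) : ℤ) = Nat.fib n * (2 * Nat.fib (n + 1) - Nat.fib n) := by
  have h := Nat.fib_two_mul_add_two n
  have h' := Nat.fib_two_mul_add_one n
  rw [Nat.fib_add_two] at h
  zify at h h'
  linear_combination h - h'

theorem fib_lucas_mod_sq (p : ℕ) (hp : p.Prime) (h2 : p ≠ 2) (h5 : p ≠ 5) :
    ((p % 10 = 1 ∨ p % 10 = 9) →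
      ((2 * (Nat.fib (p - 1) : ℤ) - Nat.fib (2 * p - 2)) ≡ 0 [ZMOD ((p : ℤ)) ^ 2] ∧
       (2 * lucasL (p - 1) - lucasL (2 * p - 2)) ≡ 2 [ZMOD ((p : ℤ)) ^ 2])) ∧
    ((p % 10 = 3 ∨ p % 10 = 7) →
      ((2 * (Nat.fib (p - 2) : ℤ) + Nat.fib (2 * p - 1)) ≡ -2 [ZMOD ((p : ℤ)) ^ 2] ∧
       (2 * lucasL (p - 2) + lucasL (2 * p - 1)) ≡ 4 [ZMOD ((p : ℤ)) ^ 2])) := by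
  constructor
  · intro h
    obtain ⟨⟨a, ha⟩, ⟨b, hb⟩⟩ := dvd_fib_of_mod_ten_eq_one_or_nine hp h
    obtain ⟨n, rfl⟩ : ∃ n, p = n + 1 := ⟨p - 1, by omega⟩
    rw [show 2 * (n + 1) - 2 = 2 * n by omega, Nat.add_sub_cancel] at *
    have h₀ := fib_two_mul_int n
    have h₁ : (Nat.fib (2 * n + 1) : ℤ) = _ := congrArg _ (Nat.fib_two_mul_add_one n)
    push_cast at h₁ ha hb
    rw [lucasL_eq_two_mul_fib_sub, lucasL_eq_two_mul_fib_sub, h₀, h₁,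
      eq_add_of_sub_eq hb, ha]
    constructor <;> refine (Int.modEq_iff_dvd.mpr ?_).symm
    · exact ⟨a * (a - 2 * b), by push_cast; ring⟩
    · exact ⟨-2 * b ^ 2 - 3 * a ^ 2 + 2 * a * b, by push_cast; ring⟩
  · intro h
    obtain ⟨⟨a, ha⟩, ⟨c, hc⟩⟩ := dvd_fib_of_mod_ten_eq_three_or_seven hp h
    obtain ⟨n, rfl⟩ : ∃ n, p = n + 2 := ⟨p - 2, by have := hp.two_le; omega⟩
    rw [show 2 * (n + 2) - 1 = 2 * (n + 1) + 1 by omega, Nat.add_sub_cancel]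
    have h₁ : (Nat.fib (2 * (n + 1) + 1) : ℤ) = _ := congrArg _ (Nat.fib_two_mul_add_one (n + 1))
    have h₂ := fib_two_mul_int (n + 2)
    have e₀ : (Nat.fib (n + 2) : ℤ) = _ := congrArg _ (Nat.fib_add_two (n := n))
    have e₁ : (Nat.fib (n + 3) : ℤ) = _ := congrArg _ (Nat.fib_add_two (n := n + 1))
    push_cast at h₁ h₂ e₀ e₁ ha hc
    rw [show n + 2 + 1 = n + 3 from rfl] at ha h₂
    rw [show n + 1 + 1 = n + 2 from rfl] at h₁ e₁
    rw [lucasL_eq_two_mul_fib_sub, lucasL_eq_two_mul_fib_sub,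
      show 2 * (n + 1) + 1 + 1 = 2 * (n + 2) by ring, h₁, h₂]
    have f₂ := eq_sub_of_add_eq hc
    have f₁ := eq_sub_of_add_eq e₁.symm
    have f₀ := eq_sub_of_add_eq e₀.symm
    rw [ha, f₂] at f₁
    rw [f₁, f₂] at f₀
    rw [ha, f₀, f₁, f₂]
    constructor <;> refine (Int.modEq_iff_dvd.mpr ?_).symm
    · exact ⟨2 * c ^ 2 + a ^ 2 - 2 * a * c, by push_cast; ring⟩
    · exact ⟨6 * a * c - 4 * c ^ 2 - a ^ 2, by push_cast; ring⟩
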